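/- arXiv:1902.04662 — 6 statements merged into one kernel-verified Lean document; each statement's English description precedes it below -/
import Mathlib

section
/- For every α with 0 < α < √(3/44), the following quadrature rule on a triangle is exact at degree 3: let a, b, c ∈ ℝ² be affinely independent, K the closed triangle with vertices a, b, c, and |K| its area. Then for every real polynomial p in two variables of total degree at most 3, ∫_K p dλ² equals |K| times the sum of: the proportion (3 − 44α²)/(60(1 − 4α²)) times p evaluated at each of the three vertices a, b, c; the proportion 1/(15(1 − 4α²)) times p evaluated at each of the six edge points (1/2 + α)v + (1/2 − α)w where (v, w) runs over the ordered pairs of distinct vertices; and the proportion 9/20 times p evaluated at the centroid (a + b + c)/3. -/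
open MeasureTheory MvPolynomial

/-- The closed reference triangle with vertices `(0, 0)`, `(1, 0)` and `(0, 1)`. -/
def refTriangle : Set (Fin 2 → ℝ) := {x | 0 ≤ x 0 ∧ 0 ≤ x 1 ∧ x 0 + x 1 ≤ 1}

theorem isClosed_refTriangle : IsClosed refTriangle :=
  (isClosed_le continuous_const (continuous_apply 0)).inter
    ((isClosed_le continuous_const (continuous_apply 1)).inter
      (isClosed_le ((continuous_apply 0).add (continuous_apply 1)) continuous_const))

theorem isCompact_refTriangle : IsCompact refTriangle := by
  refine (isCompact_Icc (a := (0 : Fin 2 → ℝ)) (b := 1)).of_isClosed_subset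
    isClosed_refTriangle ?_
  rintro x ⟨h0, h1, h⟩
  refine ⟨fun i => ?_, fun i => ?_⟩ <;> fin_cases i <;> simp <;> linarith

theorem convex_refTriangle : Convex ℝ refTriangle := by
  rintro x ⟨hx0, hx1, hx⟩ y ⟨hy0, hy1, hy⟩ s t hs ht hst
  refine ⟨?_, ?_, ?_⟩ <;> simp only [Pi.add_apply, Pi.smul_apply, smul_eq_mul]
  · positivity
  · positivity
  · nlinarith

theorem setIntegral_refTriangle {f : (Fin 2 → ℝ) → ℝ} (hf : Continuous f) :
    ∫ x in refTriangle, f x = ∫ x in (0 : ℝ)..1, ∫ y in (0 : ℝ)..(1 - x), f ![x, y] := by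
  have hmp := (volume_preserving_finTwoArrow ℝ).symm
  have hfi : Integrable (refTriangle.indicator f) :=
    (hf.continuousOn.integrableOn_compact isCompact_refTriangle).integrable_indicator
      isClosed_refTriangle.measurableSet
  rw [← integral_indicator isClosed_refTriangle.measurableSet,
    ← hmp.integral_comp (MeasurableEquiv.measurableEmbedding _), Measure.volume_eq_prod,
    integral_prod (fun z => refTriangle.indicator f (MeasurableEquiv.finTwoArrow.symm z))
      (hmp.integrable_comp_of_integrable hfi),
    intervalIntegral.integral_of_le zero_le_one, ← integral_Icc_eq_integral_Ioc,
    ← integral_indicator measurableSet_Icc]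
  refine integral_congr_ae (.of_forall fun x => ?_)
  by_cases hx : x ∈ Set.Icc (0 : ℝ) 1
  · rw [Set.indicator_of_mem hx, intervalIntegral.integral_of_le (by linarith [hx.2]),
      ← integral_Icc_eq_integral_Ioc, ← integral_indicator measurableSet_Icc]
    refine integral_congr_ae (.of_forall fun y => ?_)
    have : ![x, y] ∈ refTriangle ↔ y ∈ Set.Icc 0 (1 - x) := by
      simp only [refTriangle, Set.mem_ofPred_eq, Set.mem_Icc, Matrix.cons_val_zero,
        Matrix.cons_val_one]
      exact ⟨fun h => ⟨h.2.1, by linarith⟩, fun h => ⟨hx.1, h.1, by linarith [h.2]⟩⟩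
    change refTriangle.indicator f ![x, y] = _
    by_cases hy : y ∈ Set.Icc 0 (1 - x)
    · rw [Set.indicator_of_mem hy, Set.indicator_of_mem (this.2 hy)]
    · rw [Set.indicator_of_notMem hy, Set.indicator_of_notMem (mt this.1 hy)]
  · rw [Set.indicator_of_notMem hx]
    refine (integral_congr_ae (.of_forall fun y => ?_)).trans (integral_zero _ _)
    refine Set.indicator_of_notMem (fun h : ![x, y] ∈ refTriangle => hx ?_) _
    simp only [refTriangle, Set.mem_ofPred_eq, Matrix.cons_val_zero, Matrix.cons_val_one] at h
    exact ⟨h.1, by linarith⟩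

open Nat in
theorem integral_pow_mul_one_sub_pow (i k : ℕ) :
    ∫ x in (0 : ℝ)..1, x ^ i * (1 - x) ^ k = i ! * k ! / (i + k + 1)! := by
  induction k generalizing i with
  | zero =>
    simp [Nat.factorial_succ]
    field_simp
  | succ k ih =>
    have h : ∀ x : ℝ, x ^ i * (1 - x) ^ (k + 1) =
        x ^ i * (1 - x) ^ k - x ^ (i + 1) * (1 - x) ^ k := fun x => by ring
    simp_rw [h]
    rw [intervalIntegral.integral_sub (Continuous.intervalIntegrable (by fun_prop) _ _)
      (Continuous.intervalIntegrable (by fun_prop) _ _), ih, ih,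
      show i + 1 + k + 1 = i + k + 1 + 1 by ring, show i + (k + 1) + 1 = i + k + 1 + 1 by ring,
      Nat.factorial_succ (i + k + 1), Nat.factorial_succ i, Nat.factorial_succ k]
    push_cast
    field_simp
    ring

open Nat in
theorem setIntegral_refTriangle_monomial (i j : ℕ) :
    ∫ x in refTriangle, x 0 ^ i * x 1 ^ j = i ! * j ! / (i + j + 2)! := by
  rw [setIntegral_refTriangle (by fun_prop)]
  have h : ∀ x : ℝ, ∫ y in (0 : ℝ)..(1 - x), (![x, y] 0) ^ i * (![x, y] 1) ^ j =
      x ^ i * (1 - x) ^ (j + 1) / (j + 1) := fun x => by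
    simp [mul_div_assoc]
  simp_rw [h]
  rw [intervalIntegral.integral_div, integral_pow_mul_one_sub_pow, Nat.factorial_succ j,
    ← add_assoc]
  push_cast
  field_simp

/-- The `α`-family rule on the reference triangle is exact on monomials of degree at most `3`. -/
theorem setIntegral_refTriangle_monomial_eq_rule {α : ℝ} (hα : 1 - 4 * α ^ 2 ≠ 0) {i j : ℕ}
    (hij : i + j ≤ 3) :
    ∫ x in refTriangle, x 0 ^ i * x 1 ^ j =
      1 / 2 *
        ((3 - 44 * α ^ 2) / (60 * (1 - 4 * α ^ 2)) *
            (0 ^ i * 0 ^ j + 1 ^ i * 0 ^ j + 0 ^ i * 1 ^ j)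
          + 1 / (15 * (1 - 4 * α ^ 2)) *
            ((1 / 2 - α) ^ i * 0 ^ j + (1 / 2 + α) ^ i * 0 ^ j
              + 0 ^ i * (1 / 2 - α) ^ j + 0 ^ i * (1 / 2 + α) ^ j
              + (1 / 2 + α) ^ i * (1 / 2 - α) ^ j + (1 / 2 - α) ^ i * (1 / 2 + α) ^ j)
          + 9 / 20 * ((1 / 3) ^ i * (1 / 3) ^ j)) := by
  rw [setIntegral_refTriangle_monomial]
  obtain ⟨d, hd⟩ : ∃ d, 1 - 4 * α ^ 2 = d := ⟨_, rfl⟩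
  have hA : 3 - 44 * α ^ 2 = 11 * d - 8 := by linarith
  rw [hd] at hα
  rw [hA, hd]
  have hi : i ≤ 3 := by omega
  have hj : j ≤ 3 := by omega
  interval_cases i <;> interval_cases j <;> first | omega | skip
  all_goals
    norm_num [Nat.factorial]
    field_simp
    grind

/-- The `α`-family rule on the reference triangle is exact on polynomials of degree at most `3`. -/
theorem setIntegral_refTriangle_eval_eq_rule {α : ℝ} (hα : 1 - 4 * α ^ 2 ≠ 0)
    {q : MvPolynomial (Fin 2) ℝ} (hq : q.totalDegree ≤ 3) :
    ∫ x in refTriangle, eval x q =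
      1 / 2 *
        ((3 - 44 * α ^ 2) / (60 * (1 - 4 * α ^ 2)) *
            (eval ![0, 0] q + eval ![1, 0] q + eval ![0, 1] q)
          + 1 / (15 * (1 - 4 * α ^ 2)) *
            (eval ![1 / 2 - α, 0] q + eval ![1 / 2 + α, 0] q
              + eval ![0, 1 / 2 - α] q + eval ![0, 1 / 2 + α] q
              + eval ![1 / 2 + α, 1 / 2 - α] q + eval ![1 / 2 - α, 1 / 2 + α] q)
          + 9 / 20 * eval ![1 / 3, 1 / 3] q) := by
  simp only [eval_eq', Fin.prod_univ_two]
  rw [integral_finsetSum _ fun s _ => (Continuous.continuousOn (by fun_prop)).integrableOn_compact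
    isCompact_refTriangle]
  simp only [← Finset.sum_add_distrib, Finset.mul_sum]
  refine Finset.sum_congr rfl fun s hs => ?_
  have hdeg : s 0 + s 1 ≤ 3 := by
    have := (le_totalDegree hs).trans hq
    rwa [Finsupp.sum_fintype _ _ fun _ => rfl, Fin.sum_univ_two] at this
  rw [integral_const_mul, setIntegral_refTriangle_monomial_eq_rule hα hdeg]
  simp only [Matrix.cons_val_zero, Matrix.cons_val_one]
  ring

theorem totalDegree_bind₁_le {σ τ R : Type*} [CommSemiring R] (f : σ → MvPolynomial τ R)
    (hf : ∀ i, (f i).totalDegree ≤ 1) (p : MvPolynomial σ R) :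
    (bind₁ f p).totalDegree ≤ p.totalDegree := by
  rw [← aeval_eq_bind₁, aeval_def, eval₂_eq]
  refine totalDegree_finsetSum_le fun s hs => ?_
  refine (totalDegree_mul _ _).trans ?_
  rw [algebraMap_eq, totalDegree_C, zero_add]
  refine ((totalDegree_finsetProd _ _).trans (Finset.sum_le_sum fun i _ => ?_)).trans
    (le_totalDegree hs)
  exact (totalDegree_pow _ _).trans (by simpa using Nat.mul_le_mul_left (s i) (hf i))

/-- The linear part of the affine map carrying the reference triangle to the triangle with
vertices `a`, `b`, `c`. -/
noncomputable def triangleLinear (a b c : Fin 2 → ℝ) : (Fin 2 → ℝ) →L[ℝ] (Fin 2 → ℝ) :=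
  (ContinuousLinearMap.proj (R := ℝ) (φ := fun _ : Fin 2 => ℝ) 0).smulRight (b - a) +
    (ContinuousLinearMap.proj (R := ℝ) (φ := fun _ : Fin 2 => ℝ) 1).smulRight (c - a)

theorem triangleLinear_apply (a b c x : Fin 2 → ℝ) :
    triangleLinear a b c x = x 0 • (b - a) + x 1 • (c - a) := rfl

theorem triangleLinear_injective {a b c : Fin 2 → ℝ} (h : AffineIndependent ℝ ![a, b, c]) :
    Function.Injective (triangleLinear a b c) := by
  refine (injective_iff_map_eq_zero _).2 fun x hx => ?_
  rw [triangleLinear_apply] at hx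
  rw [affineIndependent_iff] at h
  have := h Finset.univ ![-x 0 - x 1, x 0, x 1] (by simp [Fin.sum_univ_three]; ring) (by
    simp only [Fin.sum_univ_three, Matrix.cons_val]
    rw [← hx]
    module)
  ext i
  fin_cases i
  · exact this 1 (Finset.mem_univ _)
  · exact this 2 (Finset.mem_univ _)

theorem image_refTriangle (a b c : Fin 2 → ℝ) :
    (fun x => a + triangleLinear a b c x) '' refTriangle = convexHull ℝ {a, b, c} := by
  refine Set.Subset.antisymm ?_ (convexHull_min ?_ ?_)
  · rintro _ ⟨x, ⟨h0, h1, h⟩, rfl⟩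
    have hc := convex_convexHull ℝ {a, b, c}
    have hsub := subset_convexHull ℝ {a, b, c}
    have := hc.sum_mem (t := Finset.univ) (w := ![1 - x 0 - x 1, x 0, x 1]) (z := ![a, b, c])
      (by simp [Fin.forall_fin_succ, h0, h1]; linarith) (by simp [Fin.sum_univ_three]; ring)
      (by simpa [Fin.forall_fin_succ] using
        ⟨hsub (by simp), hsub (by simp), hsub (by simp)⟩)
    convert this using 1
    simp only [Fin.sum_univ_three, Matrix.cons_val, triangleLinear_apply]
    module
  · rintro x (rfl | rfl | rfl)
    · exact ⟨![0, 0], by simp [refTriangle], by simp [triangleLinear_apply]⟩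
    · exact ⟨![1, 0], by simp [refTriangle], by simp [triangleLinear_apply]⟩
    · exact ⟨![0, 1], by simp [refTriangle], by simp [triangleLinear_apply]⟩
  · have := (convex_refTriangle.linear_image (triangleLinear a b c).toLinearMap).translate a
    rwa [Set.image_image] at this

theorem setIntegral_convexHull_triple {a b c : Fin 2 → ℝ} (h : AffineIndependent ℝ ![a, b, c])
    (f : (Fin 2 → ℝ) → ℝ) :
    ∫ x in convexHull ℝ {a, b, c}, f x =
      |(triangleLinear a b c).det| * ∫ x in refTriangle, f (a + triangleLinear a b c x) := by
  rw [← image_refTriangle, integral_image_eq_integral_abs_det_fderiv_smul volume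
    isClosed_refTriangle.measurableSet
    (fun x _ => ((triangleLinear a b c).hasFDerivAt.const_add a).hasFDerivWithinAt)
    ((add_right_injective a).comp (triangleLinear_injective h)).injOn]
  simp only [smul_eq_mul, integral_const_mul]

theorem volume_convexHull_triple {a b c : Fin 2 → ℝ} (h : AffineIndependent ℝ ![a, b, c]) :
    (volume (convexHull ℝ {a, b, c})).toReal = |(triangleLinear a b c).det| * (1 / 2) := by
  have h1 := setIntegral_convexHull_triple h fun _ => 1
  have h2 := setIntegral_refTriangle_monomial 0 0
  simp only [pow_zero, mul_one] at h2
  rw [h2] at h1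
  simpa [Nat.factorial, Measure.real] using h1

theorem exists_eval_eq_eval_triangleLinear (a b c : Fin 2 → ℝ) (p : MvPolynomial (Fin 2) ℝ) :
    ∃ q : MvPolynomial (Fin 2) ℝ, q.totalDegree ≤ p.totalDegree ∧
      ∀ x, eval x q = eval (a + triangleLinear a b c x) p := by
  refine ⟨bind₁ (fun i => C (a i) + (X 0 * C (b i - a i) + X 1 * C (c i - a i))) p,
    totalDegree_bind₁_le _ (fun i => ?_) p, fun x => ?_⟩
  · have hX : ∀ (j : Fin 2) (r : ℝ), (X j * C r : MvPolynomial (Fin 2) ℝ).totalDegree ≤ 1 :=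
      fun j r => (totalDegree_mul _ _).trans (by simp)
    refine (totalDegree_add _ _).trans (max_le (by simp) ?_)
    exact (totalDegree_add _ _).trans (max_le (hX _ _) (hX _ _))
  · rw [eval, eval₂Hom_bind₁]
    congr 2
    ext i
    simp [triangleLinear_apply]

/-- For `0 < α < √(3/44)`, the α-family quadrature rule on a triangle (vertices,
six edge points at barycentric coordinates `(1/2 ± α, 1/2 ∓ α)`, and centroid)
is exact at degree 3. -/
theorem alpha_family_rule_exact_deg_three
    (α : ℝ) (hα0 : 0 < α) (hα1 : α < Real.sqrt (3 / 44))
    (a b c : Fin 2 → ℝ) (hind : AffineIndependent ℝ ![a, b, c])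
    (K : Set (Fin 2 → ℝ)) (hK : K = convexHull ℝ {a, b, c})
    (p : MvPolynomial (Fin 2) ℝ) (hp : p.totalDegree ≤ 3) :
    ∫ x in K, MvPolynomial.eval x p =
      (volume K).toReal *
        ((3 - 44 * α ^ 2) / (60 * (1 - 4 * α ^ 2)) *
            (MvPolynomial.eval a p + MvPolynomial.eval b p + MvPolynomial.eval c p)
          + 1 / (15 * (1 - 4 * α ^ 2)) *
            (MvPolynomial.eval ((1 / 2 + α) • a + (1 / 2 - α) • b) p
              + MvPolynomial.eval ((1 / 2 + α) • b + (1 / 2 - α) • a) p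
              + MvPolynomial.eval ((1 / 2 + α) • a + (1 / 2 - α) • c) p
              + MvPolynomial.eval ((1 / 2 + α) • c + (1 / 2 - α) • a) p
              + MvPolynomial.eval ((1 / 2 + α) • b + (1 / 2 - α) • c) p
              + MvPolynomial.eval ((1 / 2 + α) • c + (1 / 2 - α) • b) p)
          + (9 / 20) * MvPolynomial.eval ((a + b + c) / 3) p) := by
  have hα : 1 - 4 * α ^ 2 ≠ 0 := by
    have := (Real.lt_sqrt hα0.le).1 hα1
    linarith
  obtain ⟨q, hq, hqp⟩ := exists_eval_eq_eval_triangleLinear a b c p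
  rw [hK, setIntegral_convexHull_triple hind, volume_convexHull_triple hind]
  have hpt (x y : ℝ) (v : Fin 2 → ℝ) (hv : a + (x • (b - a) + y • (c - a)) = v) :
      eval ![x, y] q = eval v p := by
    rw [hqp, triangleLinear_apply, ← hv, Matrix.cons_val_zero, Matrix.cons_val_one,
      Matrix.cons_val_zero]
  simp only [← hqp]
  rw [setIntegral_refTriangle_eval_eq_rule hα (hq.trans hp), mul_assoc,
    hpt 0 0 a (by module), hpt 1 0 b (by module), hpt 0 1 c (by module),
    hpt (1 / 2 - α) 0 ((1 / 2 + α) • a + (1 / 2 - α) • b) (by module),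
    hpt (1 / 2 + α) 0 ((1 / 2 + α) • b + (1 / 2 - α) • a) (by module),
    hpt 0 (1 / 2 - α) ((1 / 2 + α) • a + (1 / 2 - α) • c) (by module),
    hpt 0 (1 / 2 + α) ((1 / 2 + α) • c + (1 / 2 - α) • a) (by module),
    hpt (1 / 2 + α) (1 / 2 - α) ((1 / 2 + α) • b + (1 / 2 - α) • c) (by module),
    hpt (1 / 2 - α) (1 / 2 + α) ((1 / 2 + α) • c + (1 / 2 - α) • b) (by module),
    hpt (1 / 3) (1 / 3) ((a + b + c) / 3) (by ext i; simp; ring)]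
end

section
/- Exactness at degree 4 of the α-family triangle rule forces α² = 1/12, which produces a negative vertex weight: let α ∈ (0, 1/2), let a, b, c ∈ ℝ² be affinely independent, K the closed triangle with vertices a, b, c and |K| its area, and consider the quadrature rule assigning weight proportion (3 − 44α²)/(60(1 − 4α²)) to each vertex, 1/(15(1 − 4α²)) to each of the six edge points (1/2 + α)v + (1/2 − α)w ((v, w) ordered pairs of distinct vertices), and 9/20 to the centroid (a+b+c)/3. If this rule integrates exactly every real polynomial in two variables of total degree at most 4 over K, then α² = 1/12; and for α² = 1/12 the vertex weight proportion (3 − 44α²)/(60(1 − 4α²)) equals −1/60. -/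
open MeasureTheory

/-- The standard closed triangle with vertices `(0, 0)`, `(1, 0)`, `(0, 1)`. -/
def standardTriangle : Set (Fin 2 → ℝ) := {x | 0 ≤ x 0 ∧ 0 ≤ x 1 ∧ x 0 + x 1 ≤ 1}

/-- The matrix whose columns are the edge vectors `b - a` and `c - a`. -/
def edgeMatrix (a b c : Fin 2 → ℝ) : Matrix (Fin 2) (Fin 2) ℝ :=
  !![b 0 - a 0, c 0 - a 0; b 1 - a 1, c 1 - a 1]

/-- The affine parametrization of the triangle `a, b, c` by the standard triangle. -/
def triangleMap (a b c : Fin 2 → ℝ) (x : Fin 2 → ℝ) : Fin 2 → ℝ :=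
  a + Matrix.toLin' (edgeMatrix a b c) x

theorem triangleMap_apply (a b c x : Fin 2 → ℝ) (i : Fin 2) :
    triangleMap a b c x i = a i + ((b i - a i) * x 0 + (c i - a i) * x 1) := by
  fin_cases i <;>
    simp [triangleMap, edgeMatrix, dotProduct, Fin.sum_univ_two]

theorem triangleMap_eq (a b c x : Fin 2 → ℝ) :
    triangleMap a b c x = (1 - x 0 - x 1) • a + x 0 • b + x 1 • c := by
  ext i
  simp only [triangleMap_apply, Pi.add_apply, Pi.smul_apply, smul_eq_mul]
  ring

theorem det_edgeMatrix_ne_zero {a b c : Fin 2 → ℝ} (h : AffineIndependent ℝ ![a, b, c]) :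
    (edgeMatrix a b c).det ≠ 0 := by
  intro hD
  rw [edgeMatrix, Matrix.det_fin_two_of] at hD
  rw [affineIndependent_iff] at h
  have key : ∀ s t : ℝ, (∀ i, s * (b i - a i) + t * (c i - a i) = 0) → s = 0 ∧ t = 0 := by
    intro s t hst
    have := h Finset.univ ![-s - t, s, t] (by simp [Fin.sum_univ_three]; ring) (by
      ext i
      simp [Fin.sum_univ_three]
      linarith [hst i])
    exact ⟨by simpa using this 1, by simpa using this 2⟩
  have h1 := key (c 1 - a 1) (-(b 1 - a 1))
    (Fin.forall_fin_two.2 ⟨by linarith, by ring⟩)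
  have h0 := key (c 0 - a 0) (-(b 0 - a 0))
    (Fin.forall_fin_two.2 ⟨by ring, by linarith⟩)
  have := key 1 0 (Fin.forall_fin_two.2 ⟨by linarith [h0.2], by linarith [h1.2]⟩)
  exact one_ne_zero this.1

theorem convex_standardTriangle : Convex ℝ standardTriangle := by
  rintro x ⟨hx0, hx1, hx⟩ y ⟨hy0, hy1, hy⟩ s t hs ht hst
  refine ⟨?_, ?_, ?_⟩ <;> simp only [Pi.add_apply, Pi.smul_apply, smul_eq_mul]
  · positivity
  · positivity
  · nlinarith

theorem isCompact_standardTriangle : IsCompact standardTriangle := by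
  refine (isCompact_Icc (a := (0 : Fin 2 → ℝ)) (b := 1)).of_isClosed_subset ?_ ?_
  · exact (isClosed_le continuous_const (continuous_apply 0)).inter
      ((isClosed_le continuous_const (continuous_apply 1)).inter
        (isClosed_le ((continuous_apply 0).add (continuous_apply 1)) continuous_const))
  · rintro x ⟨h0, h1, h⟩
    exact ⟨Fin.forall_fin_two.2 ⟨h0, h1⟩, Fin.forall_fin_two.2
      ⟨by simp only [Pi.one_apply]; linarith, by simp only [Pi.one_apply]; linarith⟩⟩

theorem image_triangleMap (a b c : Fin 2 → ℝ) :
    triangleMap a b c '' standardTriangle = convexHull ℝ {a, b, c} := by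
  apply Set.Subset.antisymm
  · rintro _ ⟨x, ⟨h0, h1, h⟩, rfl⟩
    have hc := convex_convexHull ℝ ({a, b, c} : Set (Fin 2 → ℝ))
    have := hc.sum_mem (t := Finset.univ) (w := ![1 - x 0 - x 1, x 0, x 1]) (z := ![a, b, c])
      (by intro i _; fin_cases i <;> simp <;> linarith)
      (by simp [Fin.sum_univ_three]; ring)
      (by intro i _; apply subset_convexHull; fin_cases i <;> simp)
    rw [triangleMap_eq]
    simpa [Fin.sum_univ_three] using this
  · apply convexHull_min
    · rintro y (rfl | rfl | rfl)
      · exact ⟨![0, 0], by simp [standardTriangle], by simp [triangleMap_eq]⟩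
      · exact ⟨![1, 0], by simp [standardTriangle], by simp [triangleMap_eq]⟩
      · exact ⟨![0, 1], by simp [standardTriangle], by simp [triangleMap_eq]⟩
    · have : triangleMap a b c '' standardTriangle =
          (fun z => a + z) '' (Matrix.toLin' (edgeMatrix a b c) '' standardTriangle) := by
        rw [Set.image_image]; rfl
      rw [this]
      exact (convex_standardTriangle.linear_image _).translate a

/-- Change of variables from a nondegenerate triangle to the standard triangle. -/
theorem setIntegral_triangle {a b c : Fin 2 → ℝ} (hD : (edgeMatrix a b c).det ≠ 0)
    (f : (Fin 2 → ℝ) → ℝ) :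
    ∫ x in convexHull ℝ {a, b, c}, f x =
      |(edgeMatrix a b c).det| * ∫ x in standardTriangle, f (triangleMap a b c x) := by
  rw [← image_triangleMap, integral_image_eq_integral_abs_det_fderiv_smul volume
    isCompact_standardTriangle.measurableSet
    (f' := fun _ => LinearMap.toContinuousLinearMap (Matrix.toLin' (edgeMatrix a b c)))]
  · simp only [ContinuousLinearMap.det, LinearMap.coe_toContinuousLinearMap,
      LinearMap.det_toLin', smul_eq_mul, integral_const_mul]
  · intro x _
    exact ((LinearMap.toContinuousLinearMap
      (Matrix.toLin' (edgeMatrix a b c))).hasFDerivAt.const_add a).hasFDerivWithinAt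
  · apply Function.Injective.injOn
    intro x y hxy
    have := Matrix.mulVec_injective_of_isUnit
      ((Matrix.isUnit_iff_isUnit_det _).2 (isUnit_iff_ne_zero.2 hD))
    exact this (by simpa [triangleMap] using hxy)

theorem setIntegral_standardTriangle (f : ℝ → ℝ → ℝ) (hf : Continuous (Function.uncurry f)) :
    ∫ x in standardTriangle, f (x 0) (x 1) = ∫ s in (0 : ℝ)..1, ∫ t in (0 : ℝ)..(1 - s), f s t := by
  set S : Set (ℝ × ℝ) := {z | 0 ≤ z.1 ∧ 0 ≤ z.2 ∧ z.1 + z.2 ≤ 1} with hS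
  have hSc : IsClosed S :=
    (isClosed_le continuous_const continuous_fst).inter
      ((isClosed_le continuous_const continuous_snd).inter
        (isClosed_le (continuous_fst.add continuous_snd) continuous_const))
  have hScomp : IsCompact S := by
    refine (isCompact_Icc (a := (0 : ℝ × ℝ)) (b := 1)).of_isClosed_subset hSc ?_
    rintro x ⟨h0, h1, h⟩
    exact ⟨⟨h0, h1⟩, ⟨by simp only [Prod.fst_one]; linarith, by simp only [Prod.snd_one]; linarith⟩⟩
  have hpre : standardTriangle = MeasurableEquiv.finTwoArrow ⁻¹' S := rfl
  have h1 : ∫ x in standardTriangle, f (x 0) (x 1) = ∫ z in S, Function.uncurry f z := by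
    rw [hpre, ← (volume_preserving_finTwoArrow ℝ).setIntegral_preimage_emb
      MeasurableEquiv.finTwoArrow.measurableEmbedding]
    rfl
  have hint : Integrable (S.indicator (Function.uncurry f)) :=
    (hf.continuousOn.integrableOn_compact hScomp).integrable_indicator hSc.measurableSet
  rw [h1, ← integral_indicator hSc.measurableSet]
  change ∫ z, _ ∂(volume.prod volume) = _
  rw [integral_prod _ hint, intervalIntegral.integral_of_le zero_le_one,
    ← integral_Icc_eq_integral_Ioc, ← integral_indicator measurableSet_Icc]
  congr 1
  ext s
  by_cases hs : s ∈ Set.Icc (0 : ℝ) 1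
  · rw [Set.indicator_of_mem hs, intervalIntegral.integral_of_le (by linarith [hs.2]),
      ← integral_Icc_eq_integral_Ioc, ← integral_indicator measurableSet_Icc]
    congr 1
    ext t
    have : (s, t) ∈ S ↔ t ∈ Set.Icc 0 (1 - s) :=
      ⟨fun h => ⟨h.2.1, by linarith [h.2.2]⟩, fun h => ⟨hs.1, h.1, by
        change s + t ≤ 1
        linarith [h.2]⟩⟩
    by_cases ht : t ∈ Set.Icc 0 (1 - s)
    · rw [Set.indicator_of_mem (this.2 ht), Set.indicator_of_mem ht, Function.uncurry_apply_pair]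
    · rw [Set.indicator_of_notMem (mt this.1 ht), Set.indicator_of_notMem ht]
  · rw [Set.indicator_of_notMem hs]
    have : ∀ t, (s, t) ∉ S := fun t h => hs ⟨h.1, by
      have h2 : 0 ≤ t := h.2.1
      have h3 : s + t ≤ 1 := h.2.2
      linarith⟩
    simp [Set.indicator, this]

theorem setIntegral_standardTriangle_one : ∫ _x in standardTriangle, (1 : ℝ) = 1 / 2 := by
  rw [setIntegral_standardTriangle (fun _ _ => 1) continuous_const]
  simp only [integral_one, sub_zero]
  rw [intervalIntegral.integral_sub intervalIntegrable_const intervalIntegral.intervalIntegrable_id,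
    integral_one, integral_id]
  norm_num

theorem setIntegral_standardTriangle_sq_mul_sq :
    ∫ x in standardTriangle, (x 0 ^ 2 * x 1 ^ 2 : ℝ) = 1 / 180 := by
  rw [setIntegral_standardTriangle (fun s t => s ^ 2 * t ^ 2) (by fun_prop)]
  have : ∀ s : ℝ, ∫ t in (0 : ℝ)..(1 - s), s ^ 2 * t ^ 2 =
      s ^ 2 / 3 - s ^ 3 + s ^ 4 - s ^ 5 / 3 := by
    intro s
    rw [intervalIntegral.integral_const_mul, integral_pow]
    norm_num
    ring
  simp only [this]
  rw [intervalIntegral.integral_sub, intervalIntegral.integral_add, intervalIntegral.integral_sub]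
  · simp only [intervalIntegral.integral_div, integral_pow]
    norm_num
  all_goals exact Continuous.intervalIntegrable (by fun_prop) _ _

open MvPolynomial in
/-- The affine polynomial `x ↦ det (x - a, v - a)`. -/
noncomputable def edgePolynomial (a v : Fin 2 → ℝ) : MvPolynomial (Fin 2) ℝ :=
  C (v 1 - a 1) * (X 0 - C (a 0)) - C (v 0 - a 0) * (X 1 - C (a 1))

theorem eval_edgePolynomial (a v x : Fin 2 → ℝ) :
    MvPolynomial.eval x (edgePolynomial a v) =
      (v 1 - a 1) * (x 0 - a 0) - (v 0 - a 0) * (x 1 - a 1) := by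
  simp [edgePolynomial]

theorem totalDegree_edgePolynomial_le (a v : Fin 2 → ℝ) :
    (edgePolynomial a v).totalDegree ≤ 1 := by
  have h : ∀ (r s : ℝ) (i : Fin 2), (MvPolynomial.C r *
      (MvPolynomial.X i - MvPolynomial.C s)).totalDegree ≤ 1 := fun r s i =>
    (MvPolynomial.totalDegree_mul _ _).trans (by
      rw [MvPolynomial.totalDegree_C, zero_add]
      exact (MvPolynomial.totalDegree_sub_C_le _ _).trans (MvPolynomial.totalDegree_X i).le)
  exact (MvPolynomial.totalDegree_sub _ _).trans (max_le (h _ _ _) (h _ _ _))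

theorem totalDegree_edgePolynomial_sq_mul_sq_le (a v w : Fin 2 → ℝ) :
    (edgePolynomial a v ^ 2 * edgePolynomial a w ^ 2).totalDegree ≤ 4 := by
  have h := fun u => MvPolynomial.totalDegree_pow (edgePolynomial a u) 2
  have h1 := fun u => totalDegree_edgePolynomial_le a u
  have := MvPolynomial.totalDegree_mul (edgePolynomial a v ^ 2) (edgePolynomial a w ^ 2)
  linarith [h v, h w, h1 v, h1 w]

theorem eval_edgePolynomial_triangleMap (a b c x : Fin 2 → ℝ) :
    MvPolynomial.eval (triangleMap a b c x) (edgePolynomial a c ^ 2 * edgePolynomial a b ^ 2) =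
      (edgeMatrix a b c).det ^ 4 * (x 0 ^ 2 * x 1 ^ 2) := by
  simp only [map_mul, map_pow, eval_edgePolynomial, triangleMap_apply, edgeMatrix,
    Matrix.det_fin_two_of]
  ring

/-- If the α-family triangle quadrature rule is exact at degree 4, then `α² = 1/12`;
and for `α² = 1/12` the vertex weight proportion equals `−1/60`. -/
theorem alpha_family_deg_four_forces_negative_weight
    (α : ℝ) (hα0 : 0 < α) (hα1 : α < 1 / 2)
    (a b c : Fin 2 → ℝ) (hind : AffineIndependent ℝ ![a, b, c])
    (K : Set (Fin 2 → ℝ)) (hK : K = convexHull ℝ {a, b, c})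
    (hexact : ∀ p : MvPolynomial (Fin 2) ℝ, p.totalDegree ≤ 4 →
      ∫ x in K, MvPolynomial.eval x p =
        (volume K).toReal *
          ((3 - 44 * α ^ 2) / (60 * (1 - 4 * α ^ 2)) *
              (MvPolynomial.eval a p + MvPolynomial.eval b p + MvPolynomial.eval c p)
            + 1 / (15 * (1 - 4 * α ^ 2)) *
              (MvPolynomial.eval ((1 / 2 + α) • a + (1 / 2 - α) • b) p
                + MvPolynomial.eval ((1 / 2 + α) • b + (1 / 2 - α) • a) p
                + MvPolynomial.eval ((1 / 2 + α) • a + (1 / 2 - α) • c) p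
                + MvPolynomial.eval ((1 / 2 + α) • c + (1 / 2 - α) • a) p
                + MvPolynomial.eval ((1 / 2 + α) • b + (1 / 2 - α) • c) p
                + MvPolynomial.eval ((1 / 2 + α) • c + (1 / 2 - α) • b) p)
            + (9 / 20) * MvPolynomial.eval ((a + b + c) / 3) p)) :
    α ^ 2 = 1 / 12 ∧
      (3 - 44 * α ^ 2) / (60 * (1 - 4 * α ^ 2)) = -(1 / 60) := by
  have hD := det_edgeMatrix_ne_zero hind
  set D := (edgeMatrix a b c).det with hDdef
  have hvol : (volume K).toReal = |D| * (1 / 2) := by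
    rw [← setIntegral_standardTriangle_one, hDdef, hK, ← setIntegral_triangle hD fun _ => 1]
    simp [Measure.real]
  have hp := hexact _ (totalDegree_edgePolynomial_sq_mul_sq_le a c b)
  have heval : ∀ (s t : ℝ) (x : Fin 2 → ℝ), x = triangleMap a b c ![s, t] →
      MvPolynomial.eval x (edgePolynomial a c ^ 2 * edgePolynomial a b ^ 2) =
        D ^ 4 * (s ^ 2 * t ^ 2) := by
    rintro s t x rfl
    simpa using eval_edgePolynomial_triangleMap a b c ![s, t]
  have hx : ∀ (s t : ℝ) (x : Fin 2 → ℝ),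
      (∀ i, x i = a i + ((b i - a i) * s + (c i - a i) * t)) →
      x = triangleMap a b c ![s, t] := by
    intro s t x h
    ext i
    simp [triangleMap_apply, h i]
  have hpos : 0 < 1 - 4 * α ^ 2 := by nlinarith
  rw [hvol, hK, setIntegral_triangle hD,
    heval 0 0 a (hx _ _ _ fun i => by ring),
    heval 1 0 b (hx _ _ _ fun i => by ring),
    heval 0 1 c (hx _ _ _ fun i => by ring),
    heval (1 / 2 - α) 0 ((1 / 2 + α) • a + (1 / 2 - α) • b)
      (hx _ _ _ fun i => by simp only [Pi.add_apply, Pi.smul_apply, smul_eq_mul]; ring),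
    heval (1 / 2 + α) 0 ((1 / 2 + α) • b + (1 / 2 - α) • a)
      (hx _ _ _ fun i => by simp only [Pi.add_apply, Pi.smul_apply, smul_eq_mul]; ring),
    heval 0 (1 / 2 - α) ((1 / 2 + α) • a + (1 / 2 - α) • c)
      (hx _ _ _ fun i => by simp only [Pi.add_apply, Pi.smul_apply, smul_eq_mul]; ring),
    heval 0 (1 / 2 + α) ((1 / 2 + α) • c + (1 / 2 - α) • a)
      (hx _ _ _ fun i => by simp only [Pi.add_apply, Pi.smul_apply, smul_eq_mul]; ring),
    heval (1 / 2 + α) (1 / 2 - α) ((1 / 2 + α) • b + (1 / 2 - α) • c)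
      (hx _ _ _ fun i => by simp only [Pi.add_apply, Pi.smul_apply, smul_eq_mul]; ring),
    heval (1 / 2 - α) (1 / 2 + α) ((1 / 2 + α) • c + (1 / 2 - α) • b)
      (hx _ _ _ fun i => by simp only [Pi.add_apply, Pi.smul_apply, smul_eq_mul]; ring),
    heval (1 / 3) (1 / 3) ((a + b + c) / 3)
      (hx _ _ _ fun i => by simp only [Pi.add_apply, Pi.div_apply, Pi.ofNat_apply]; ring)] at hp
  simp only [eval_edgePolynomial_triangleMap, integral_const_mul,
    setIntegral_standardTriangle_sq_mul_sq] at hp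
  have hcancel : |D| * D ^ 4 ≠ 0 := mul_ne_zero (abs_ne_zero.2 hD) (pow_ne_zero 4 hD)
  have hα : 1 / 90 = 1 / (15 * (1 - 4 * α ^ 2)) * (2 * ((1 / 2 + α) * (1 / 2 - α)) ^ 2)
      + 9 / 20 * (1 / 81) := by
    apply mul_left_cancel₀ hcancel
    linear_combination 2 * hp
  have hsq : α ^ 2 = 1 / 12 := by
    have h : 1 / (15 * (1 - 4 * α ^ 2)) * (2 * ((1 / 2 + α) * (1 / 2 - α)) ^ 2) =
        (1 - 4 * α ^ 2) / 120 := by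
      field_simp
      ring
    rw [h] at hα
    linarith
  exact ⟨hsq, by rw [hsq]; norm_num⟩
end

section
/- The porous-medium test case with nonzero source has the stated exact solution: define y(x) = max(x − 1/5, 0), z(x) = max(4/5 − x, 0), ū(x) = (y(x)z(x))^{3/2}, g(x) = (y(x)z(x))³ and f(x) = (y(x)z(x))^{3/2} − 6 y(x)z(x)( z(x)² − 3 y(x)z(x) + y(x)² ). Then g(x) = ζ_p(ū(x)) for all x, g is twice differentiable on ℝ, and for every x ∈ ℝ one has ū(x) − g″(x) = f(x). -/
/-- Powers of the positive part of exponent at least two are differentiable, with the expected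
derivative. -/
theorem hasDerivAt_posPart_pow (n : ℕ) (a : ℝ) :
    HasDerivAt (fun t : ℝ => max t 0 ^ (n + 2)) ((n + 2) * max a 0 ^ (n + 1)) a := by
  have hpow : HasDerivAt (fun t : ℝ => t ^ (n + 2)) ((n + 2) * a ^ (n + 1)) a := by
    simpa using hasDerivAt_pow (n + 2) a
  rcases lt_trichotomy a 0 with ha | rfl | ha
  · rw [max_eq_right ha.le]
    have h := hasDerivAt_const a (0 : ℝ)
    refine (h.congr_of_eventuallyEq ?_).congr_deriv (by simp)
    filter_upwards [Iio_mem_nhds ha] with t ht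
    simp [max_eq_right (Set.mem_Iio.mp ht).le]
  · simp only [max_self]
    rw [← hasDerivWithinAt_univ, ← Set.Iic_union_Ici (a := (0 : ℝ))]
    refine HasDerivWithinAt.union ?_ ?_
    · refine ((hasDerivWithinAt_const (0 : ℝ) (Set.Iic 0) (0 : ℝ)).congr ?_ ?_).congr_deriv
        (by simp)
      · intro t ht
        simp [max_eq_right (Set.mem_Iic.mp ht)]
      · simp
    · refine hpow.hasDerivWithinAt.congr ?_ ?_
      · intro t ht
        simp only [max_eq_left (Set.mem_Ici.mp ht)]
      · simp
  · rw [max_eq_left ha.le]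
    refine hpow.congr_of_eventuallyEq ?_
    filter_upwards [Ioi_mem_nhds ha] with t ht
    simp only [max_eq_left (Set.mem_Ioi.mp ht).le]

/-- The porous-medium test case with nonzero source: with
`y(x) = max(x − 1/5, 0)`, `z(x) = max(4/5 − x, 0)`, `ū = (yz)^{3/2}`, `g = (yz)³` and
`f = (yz)^{3/2} − 6yz(z² − 3yz + y²)`, one has `g = ζ_p ∘ ū`, `g` is twice
differentiable, and `ū − g″ = f` everywhere. -/
theorem porous_medium_nonzero_source_exact_solution
    (ζp : ℝ → ℝ) (hζp : ∀ s : ℝ, ζp s = max s 0 ^ 2)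
    (y z u g f : ℝ → ℝ)
    (hy : ∀ x : ℝ, y x = max (x - 1 / 5) 0)
    (hz : ∀ x : ℝ, z x = max (4 / 5 - x) 0)
    (hu : ∀ x : ℝ, u x = (y x * z x) ^ ((3 : ℝ) / 2))
    (hg : ∀ x : ℝ, g x = (y x * z x) ^ 3)
    (hf : ∀ x : ℝ, f x = (y x * z x) ^ ((3 : ℝ) / 2)
      - 6 * (y x * z x) * (z x ^ 2 - 3 * (y x * z x) + y x ^ 2)) :
    (∀ x : ℝ, g x = ζp (u x)) ∧
    Differentiable ℝ g ∧ Differentiable ℝ (deriv g) ∧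
    ∀ x : ℝ, u x - deriv (deriv g) x = f x := by
  have hy_nonneg : ∀ x, 0 ≤ y x := fun x => by rw [hy]; exact le_max_right _ _
  have hz_nonneg : ∀ x, 0 ≤ z x := fun x => by rw [hz]; exact le_max_right _ _
  have hy_deriv : ∀ (n : ℕ) (x : ℝ),
      HasDerivAt (fun t => y t ^ (n + 2)) ((n + 2) * y x ^ (n + 1)) x := by
    intro n x
    simp only [hy]
    exact ((hasDerivAt_posPart_pow n (x - 1 / 5)).comp x
      ((hasDerivAt_id x).sub_const (1 / 5))).congr_deriv (mul_one _)
  have hz_deriv : ∀ (n : ℕ) (x : ℝ),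
      HasDerivAt (fun t => z t ^ (n + 2)) (-((n + 2) * z x ^ (n + 1))) x := by
    intro n x
    simp only [hz]
    exact ((hasDerivAt_posPart_pow n (4 / 5 - x)).comp x
      ((hasDerivAt_id x).const_sub (4 / 5))).congr_deriv (mul_neg_one _)
  have hg_deriv : ∀ x, HasDerivAt g (3 * (y x ^ 2 * z x ^ 3) - 3 * (y x ^ 3 * z x ^ 2)) x := by
    intro x
    have hg_eq : g = fun t => y t ^ 3 * z t ^ 3 := funext fun t => by rw [hg, mul_pow]
    rw [hg_eq]
    refine ((hy_deriv 1 x).mul (hz_deriv 1 x)).congr_deriv ?_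
    push_cast
    ring
  have hg_deriv_two : ∀ x, HasDerivAt (deriv g)
      (6 * (y x * z x) * (z x ^ 2 - 3 * (y x * z x) + y x ^ 2)) x := by
    intro x
    rw [show deriv g = fun t => 3 * (y t ^ 2 * z t ^ 3) - 3 * (y t ^ 3 * z t ^ 2) from
      funext fun t => (hg_deriv t).deriv]
    refine ((((hy_deriv 0 x).mul (hz_deriv 1 x)).const_mul 3).sub
      (((hy_deriv 1 x).mul (hz_deriv 0 x)).const_mul 3)).congr_deriv ?_
    push_cast
    ring
  refine ⟨fun x => ?_, fun x => (hg_deriv x).differentiableAt,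
    fun x => (hg_deriv_two x).differentiableAt, fun x => ?_⟩
  · have hyz : 0 ≤ y x * z x := mul_nonneg (hy_nonneg x) (hz_nonneg x)
    rw [hg, hζp, hu, max_eq_left (Real.rpow_nonneg hyz _), ← Real.rpow_mul_natCast hyz,
      ← Real.rpow_natCast]
    norm_num
  · rw [(hg_deriv_two x).deriv, hu, hf]
end

section
/- The Stefan test case with zero source has the stated exact solution: let γ ∈ (0, 1) and define ū(x) = cosh(x − γ) for x ≥ γ and ū(x) = 0 for x < γ, and let w = ζ_s ∘ ū. Then: (i) w(x) = cosh(x − γ) − 1 for x ≥ γ and w(x) = 0 for x < γ; (ii) w is differentiable on all of ℝ with w′(x) = sinh(max(x − γ, 0)); and (iii) for every x ≠ γ, w′ is differentiable at x with w″(x) = ū(x), i.e. ū(x) − (ζ_s(ū))″(x) = 0 for all x ≠ γ. -/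
theorem hasDerivAt_cosh_sub (γ x : ℝ) :
    HasDerivAt (fun y : ℝ => Real.cosh (y - γ)) (Real.sinh (x - γ)) x := by
  simpa using ((hasDerivAt_id x).sub_const γ).cosh

theorem hasDerivAt_sinh_sub (γ x : ℝ) :
    HasDerivAt (fun y : ℝ => Real.sinh (y - γ)) (Real.cosh (x - γ)) x := by
  simpa using ((hasDerivAt_id x).sub_const γ).sinh

/-- A function equal to `cosh (x - γ) - 1` to the right of `γ` and to `0` to the left of `γ` is
differentiable everywhere, including at `γ`. -/
theorem hasDerivAt_of_eq_cosh_sub_one_of_eq_zero {γ : ℝ} {w : ℝ → ℝ}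
    (hright : ∀ x, γ ≤ x → w x = Real.cosh (x - γ) - 1) (hleft : ∀ x, x < γ → w x = 0) (x : ℝ) :
    HasDerivAt w (Real.sinh (max (x - γ) 0)) x := by
  rcases lt_trichotomy x γ with h | rfl | h
  · rw [max_eq_right (by linarith), Real.sinh_zero]
    refine (hasDerivAt_const x (0 : ℝ)).congr_of_eventuallyEq ?_
    filter_upwards [Iio_mem_nhds h] with y hy using hleft y hy
  · have hw : w x = 0 := by simp [hright x le_rfl]
    have hl : HasDerivWithinAt w 0 (Set.Iic x) x := by
      refine (hasDerivWithinAt_const x (Set.Iic x) (0 : ℝ)).congr (fun y hy => ?_) hw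
      rcases (Set.mem_Iic.mp hy).lt_or_eq with hlt | rfl
      exacts [hleft y hlt, hw]
    have hr : HasDerivWithinAt w 0 (Set.Ici x) x := by
      have h := ((hasDerivAt_cosh_sub x x).sub_const 1).hasDerivWithinAt (s := Set.Ici x)
      rw [sub_self, Real.sinh_zero] at h
      exact h.congr (fun y hy => hright y hy) (hright x le_rfl)
    have h := hl.union hr
    rw [Set.Iic_union_Ici, hasDerivWithinAt_univ] at h
    simpa using h
  · rw [max_eq_left (by linarith)]
    refine ((hasDerivAt_cosh_sub γ x).sub_const 1).congr_of_eventuallyEq ?_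
    filter_upwards [Ioi_mem_nhds h] with y hy using hright y (le_of_lt hy)

/-- Away from the free boundary `γ`, the function `x ↦ sinh (max (x - γ) 0)` is differentiable. -/
theorem hasDerivAt_sinh_max {γ x : ℝ} (hx : x ≠ γ) :
    HasDerivAt (fun y : ℝ => Real.sinh (max (y - γ) 0))
      (if γ ≤ x then Real.cosh (x - γ) else 0) x := by
  rcases hx.lt_or_gt with h | h
  · rw [if_neg (not_le.mpr h)]
    refine (hasDerivAt_const x (0 : ℝ)).congr_of_eventuallyEq ?_
    filter_upwards [Iio_mem_nhds h] with y hy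
    rw [max_eq_right (sub_nonpos.mpr (le_of_lt hy)), Real.sinh_zero]
  · rw [if_pos h.le]
    refine (hasDerivAt_sinh_sub γ x).congr_of_eventuallyEq ?_
    filter_upwards [Ioi_mem_nhds h] with y hy
    rw [max_eq_left (sub_nonneg.mpr (le_of_lt hy))]

/-- The Stefan test case with zero source: for `γ ∈ (0, 1)`, with
`ū(x) = cosh(x − γ)` for `x ≥ γ` and `ū(x) = 0` for `x < γ`, and `w = ζ_s ∘ ū`, one has
(i) `w(x) = cosh(x − γ) − 1` for `x ≥ γ` and `w(x) = 0` for `x < γ`;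
(ii) `w` is differentiable with `w′(x) = sinh(max(x − γ, 0))`;
(iii) for every `x ≠ γ`, `w′` is differentiable at `x` with `w″(x) = ū(x)`. -/
theorem stefan_zero_source_exact_solution
    (γ : ℝ) (hγ0 : 0 < γ) (hγ1 : γ < 1)
    (ζs : ℝ → ℝ)
    (hζs : ∀ s : ℝ, ζs s = if s < 0 then s else if s ≤ 1 then 0 else s - 1)
    (u w : ℝ → ℝ)
    (hu : ∀ x : ℝ, u x = if γ ≤ x then Real.cosh (x - γ) else 0)
    (hw : w = ζs ∘ u) :
    ((∀ x : ℝ, γ ≤ x → w x = Real.cosh (x - γ) - 1) ∧ ∀ x : ℝ, x < γ → w x = 0) ∧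
    (Differentiable ℝ w ∧ ∀ x : ℝ, deriv w x = Real.sinh (max (x - γ) 0)) ∧
    (∀ x : ℝ, x ≠ γ →
      DifferentiableAt ℝ (deriv w) x ∧ u x - deriv (deriv w) x = 0) := by
  have hright : ∀ x : ℝ, γ ≤ x → w x = Real.cosh (x - γ) - 1 := by
    intro x hx
    have h1 := Real.one_le_cosh (x - γ)
    rw [hw, Function.comp_apply, hu, if_pos hx, hζs, if_neg (by linarith)]
    split_ifs with h
    · linarith
    · rfl
  have hleft : ∀ x : ℝ, x < γ → w x = 0 := by
    intro x hx
    simp [hw, hu, hζs, not_le.mpr hx]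
  have hderiv := hasDerivAt_of_eq_cosh_sub_one_of_eq_zero hright hleft
  have hderiv_eq : deriv w = fun x => Real.sinh (max (x - γ) 0) :=
    funext fun x => (hderiv x).deriv
  refine ⟨⟨hright, hleft⟩, ⟨fun x => (hderiv x).differentiableAt, fun x => (hderiv x).deriv⟩, ?_⟩
  intro x hx
  have h := hasDerivAt_sinh_max hx
  rw [hderiv_eq, h.deriv, hu]
  exact ⟨h.differentiableAt, sub_self _⟩
end

section
/- On the middle interval of the Stefan test case with nonzero F, the stated formula is an exact solution: define ū(x) = 5 − 4 cosh(x − 1/2)/cosh(1/4). Then for every x with 1/4 ≤ x ≤ 3/4 one has ū(x) ≥ 1 (with equality at x = 1/4 and x = 3/4); for every x with 1/4 < x < 3/4 one has ζ_s(ū(x)) = ū(x) − 1; and for every x with 1/4 < x < 3/4 the function x ↦ ζ_s(ū(x)) is twice differentiable at x with ū(x) − (ζ_s ∘ ū)″(x) = 5. -/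
/-- The Stefan test case with nonzero `F`, on the middle interval: with
`ū(x) = 5 − 4 cosh(x − 1/2)/cosh(1/4)`, one has `ū ≥ 1` on `[1/4, 3/4]` with equality
at the endpoints, `ζ_s(ū(x)) = ū(x) − 1` on `(1/4, 3/4)`, and `ζ_s ∘ ū` is twice
differentiable on `(1/4, 3/4)` with `ū(x) − (ζ_s ∘ ū)″(x) = 5` there. -/
theorem stefan_nonzero_F_middle_interval_exact_solution
    (ζs : ℝ → ℝ)
    (hζs : ∀ s : ℝ, ζs s = if s < 0 then s else if s ≤ 1 then 0 else s - 1)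
    (u : ℝ → ℝ)
    (hu : ∀ x : ℝ, u x = 5 - 4 * Real.cosh (x - 1 / 2) / Real.cosh (1 / 4)) :
    (∀ x : ℝ, 1 / 4 ≤ x → x ≤ 3 / 4 → 1 ≤ u x) ∧
    u (1 / 4) = 1 ∧ u (3 / 4) = 1 ∧
    (∀ x : ℝ, 1 / 4 < x → x < 3 / 4 → ζs (u x) = u x - 1) ∧
    (∀ x : ℝ, 1 / 4 < x → x < 3 / 4 →
      DifferentiableAt ℝ (ζs ∘ u) x ∧ DifferentiableAt ℝ (deriv (ζs ∘ u)) x ∧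
        u x - deriv (deriv (ζs ∘ u)) x = 5) := by
  have hc : 0 < Real.cosh (1 / 4) := Real.cosh_pos _
  have one_le_u : ∀ x : ℝ, 1 / 4 ≤ x → x ≤ 3 / 4 → 1 ≤ u x := by
    intro x h₁ h₂
    have hcosh : Real.cosh (x - 1 / 2) ≤ Real.cosh (1 / 4) := by
      rw [Real.cosh_le_cosh, abs_of_pos (by norm_num : (0 : ℝ) < 1 / 4), abs_le]
      constructor <;> linarith
    have hquot : 4 * Real.cosh (x - 1 / 2) / Real.cosh (1 / 4) ≤ 4 := by
      rw [div_le_iff₀ hc]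
      linarith
    rw [hu]
    linarith
  have ζs_eq : ∀ x : ℝ, 1 / 4 ≤ x → x ≤ 3 / 4 → ζs (u x) = u x - 1 := by
    intro x h₁ h₂
    have h := one_le_u x h₁ h₂
    rw [hζs, if_neg (by linarith)]
    split_ifs with h'
    · linarith
    · rfl
  refine ⟨one_le_u, ?_, ?_, fun x h₁ h₂ => ζs_eq x h₁.le h₂.le, ?_⟩
  · rw [hu, show (1 / 4 - 1 / 2 : ℝ) = -(1 / 4) by norm_num, Real.cosh_neg,
      mul_div_cancel_right₀ _ hc.ne']
    norm_num
  · rw [hu, show (3 / 4 - 1 / 2 : ℝ) = 1 / 4 by norm_num, mul_div_cancel_right₀ _ hc.ne']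
    norm_num
  · intro x h₁ h₂
    have hderiv : ∀ y ∈ Set.Ioo (1 / 4 : ℝ) (3 / 4), HasDerivAt (ζs ∘ u)
        (-(4 * Real.sinh (y - 1 / 2) / Real.cosh (1 / 4))) y := by
      intro y hy
      have h : HasDerivAt (fun z => 5 - 4 * Real.cosh (z - 1 / 2) / Real.cosh (1 / 4) - 1)
          (-(4 * (Real.sinh (y - 1 / 2) * 1) / Real.cosh (1 / 4))) y :=
        (((((hasDerivAt_id' y).sub_const (1 / 2)).cosh.const_mul 4).div_const _).const_sub
          5).sub_const 1
      rw [mul_one] at h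
      refine h.congr_of_eventuallyEq ?_
      filter_upwards [isOpen_Ioo.mem_nhds hy] with z hz
      rw [Function.comp_apply, ζs_eq z hz.1.le hz.2.le, hu]
    have hderiv₂ : HasDerivAt (deriv (ζs ∘ u))
        (-(4 * Real.cosh (x - 1 / 2) / Real.cosh (1 / 4))) x := by
      have h : HasDerivAt (fun z => -(4 * Real.sinh (z - 1 / 2) / Real.cosh (1 / 4)))
          (-(4 * (Real.cosh (x - 1 / 2) * 1) / Real.cosh (1 / 4))) x :=
        ((((hasDerivAt_id' x).sub_const (1 / 2)).sinh.const_mul 4).div_const _).fun_neg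
      rw [mul_one] at h
      refine h.congr_of_eventuallyEq ?_
      filter_upwards [isOpen_Ioo.mem_nhds (Set.mem_Ioo.mpr ⟨h₁, h₂⟩)] with z hz
      exact (hderiv z hz).deriv
    refine ⟨(hderiv x ⟨h₁, h₂⟩).differentiableAt, hderiv₂.differentiableAt, ?_⟩
    rw [hderiv₂.deriv, hu]
    ring
end

section
/- The matching conditions of the 1D Stefan test case with source f(x) = 3(1/2 − |1/2 − x|) admit a solution: there exist γ ∈ (0, 1/2) and real numbers a, b such that 3(1/2 − γ) − 1 + a e^{γ} + b e^{−γ} = 0, −3 + a e^{γ} − b e^{−γ} = 0, and −3 + a − b = 0. -/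
/-- Eliminating `a` and `b` from the matching conditions leaves a scalar equation for `γ`,
which has a root in `(1/6, 1/2)`. -/
theorem exists_root_stefan_interface_equation :
    ∃ γ ∈ Set.Ioo (1 / 6 : ℝ) (1 / 2),
      (5 / 2 + 3 * γ) * Real.exp (-γ) + (7 / 2 - 3 * γ) * Real.exp γ = 6 := by
  have hcont : ContinuousOn (fun γ : ℝ =>
      (5 / 2 + 3 * γ) * Real.exp (-γ) + (7 / 2 - 3 * γ) * Real.exp γ)
      (Set.Icc (1 / 6) (1 / 2)) := by fun_prop
  refine intermediate_value_Ioo' (by norm_num) hcont ⟨?_, ?_⟩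
  · have h_gt : 1 < Real.exp (1 / 2) := Real.one_lt_exp_iff.2 (by norm_num)
    have h_sq : Real.exp (1 / 2) * Real.exp (1 / 2) = Real.exp 1 := by
      rw [← Real.exp_add]; norm_num
    have h_lt : Real.exp (1 / 2) < 2 := by
      nlinarith [Real.exp_one_lt_d9]
    have h_inv : Real.exp (-(1 / 2)) * Real.exp (1 / 2) = 1 := by
      rw [← Real.exp_add]; norm_num
    have h_pos := Real.exp_pos (-(1 / 2))
    nlinarith [mul_pos h_pos (mul_pos (sub_pos.2 h_gt) (sub_pos.2 h_lt))]
  · have h_cosh : 1 < Real.cosh (1 / 6) := Real.one_lt_cosh.2 (by norm_num)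
    rw [Real.cosh_eq] at h_cosh
    linarith

/-- The matching conditions of the 1D Stefan test case with source
`f(x) = 3(1/2 − |1/2 − x|)` admit a solution: there exist `γ ∈ (0, 1/2)` and reals
`a, b` satisfying the continuity, C¹-matching and symmetry conditions. -/
theorem stefan_matching_conditions_solvable :
    ∃ (γ a b : ℝ), 0 < γ ∧ γ < 1 / 2 ∧
      3 * (1 / 2 - γ) - 1 + a * Real.exp γ + b * Real.exp (-γ) = 0 ∧
      -3 + a * Real.exp γ - b * Real.exp (-γ) = 0 ∧
      -3 + a - b = 0 := by
  obtain ⟨γ, ⟨hγ, hγ'⟩, hroot⟩ := exists_root_stefan_interface_equation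
  have h_inv : Real.exp γ * Real.exp (-γ) = 1 := by rw [← Real.exp_add]; simp
  refine ⟨γ, (5 / 2 + 3 * γ) / 2 * Real.exp (-γ), (3 * γ - 7 / 2) / 2 * Real.exp γ,
    by linarith, hγ', ?_, ?_, ?_⟩
  · linear_combination (3 * γ - 1 / 2) * h_inv
  · linear_combination 3 * h_inv
  · linear_combination 1 / 2 * hroot
end
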